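/- Characterization of infinitesimal conformal mappings: let Ω ⊆ ℝ³ be open and connected and let φ : Ω → ℝ³ be of class C² such that for every x ∈ Ω the Jacobian ∇φ(x) lies in ℝ·1 ⊕ so(3), i.e. dev(sym(∇φ(x))) = 0. Then there exist w, b̂ ∈ ℝ³, p̂ ∈ ℝ and a skew-symmetric 3×3 matrix Â such that φ(x) = (1/2)·(2⟨w,x⟩·x − ‖x‖²·w) + p̂·x + Â·x + b̂ for all x ∈ Ω. -/

import Mathlib

open Matrix MeasureTheory

noncomputable section

abbrev V3 : Type := Fin 3 → ℝ
abbrev M3 : Type := Matrix (Fin 3) (Fin 3) ℝ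

/-- Partial derivative `∂ⱼ f`. -/
def pd (j : Fin 3) (f : V3 → ℝ) (x : V3) : ℝ := fderiv ℝ f x (Pi.single j 1)

/-- Levi-Civita symbol `ε i j k`. -/
def lc (i j k : Fin 3) : ℝ :=
  ((j.val : ℝ) - i.val) * ((k.val : ℝ) - j.val) * ((k.val : ℝ) - i.val) / 2

/-- Gradient (Jacobian) of a vector field: `(∇u)ᵢⱼ = ∂ⱼ uᵢ`. -/
def grad (u : V3 → V3) (x : V3) : M3 := Matrix.of fun i j => pd j (fun y => u y i) x

/-- curl of a vector field: `(curl u)ᵢ = ε i j k ∂ⱼ uₖ`. -/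
def vcurl (u : V3 → V3) (x : V3) : V3 := fun i => ∑ j, ∑ k, lc i j k * pd j (fun y => u y k) x

/-- divergence of a vector field. -/
def vdiv (u : V3 → V3) (x : V3) : ℝ := ∑ i, pd i (fun y => u y i) x

/-- Row-wise Curl of a matrix field: `(Curl P)ᵢⱼ = ε j k l ∂ₖ P i l`. -/
def mCurl (P : V3 → M3) (x : V3) : M3 :=
  Matrix.of fun i j => ∑ k, ∑ l, lc j k l * pd k (fun y => P y i l) x

/-- Row-wise divergence of a matrix field: `(Div P)ᵢ = ∂ⱼ P i j`. -/
def mDiv (P : V3 → M3) (x : V3) : V3 := fun i => ∑ j, pd j (fun y => P y i j) x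

/-- Symmetric part of a matrix. -/
def symM (X : M3) : M3 := (1/2 : ℝ) • (X + Xᵀ)

/-- Skew-symmetric part of a matrix. -/
def skewM (X : M3) : M3 := (1/2 : ℝ) • (X - Xᵀ)

/-- Deviatoric (trace-free) part of a matrix. -/
def devM (X : M3) : M3 := X - (Matrix.trace X / 3) • (1 : M3)

/-- The axial vector of a (skew-symmetric) matrix: `axl Ā = (Ā₃₂, Ā₁₃, Ā₂₁)`. -/
def axl (X : M3) : V3 := ![X 2 1, X 0 2, X 1 0]

/-- `(anti v)ᵢⱼ = -ε i j k vₖ`. -/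
def antiV (v : V3) : M3 := Matrix.of fun i j => -∑ k, lc i j k * v k

/-- Cross product on `ℝ³`. -/
def cross3 (a b : V3) : V3 := fun i => ∑ j, ∑ k, lc i j k * a j * b k

/-- Euclidean inner product on `ℝ³`. -/
def dot3 (a b : V3) : ℝ := ∑ i, a i * b i

/-- Squared Frobenius norm of a matrix. -/
def frob2 (X : M3) : ℝ := ∑ i, ∑ j, (X i j) ^ 2

/-- Infinitesimal conformal mapping
`φ_c(x) = (1/2)(2⟨w,x⟩x − ‖x‖²w) + p̂ x + Â x + b̂`. -/
def conf (w : V3) (p : ℝ) (A : M3) (b : V3) (x : V3) : V3 :=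
  fun i => (1/2 : ℝ) * (2 * dot3 w x * x i - (∑ j, (x j) ^ 2) * w i)
    + p * x i + A.mulVec x i + b i

theorem differentiableAt_pd {f : V3 → ℝ} {x : V3} (hf : ContDiffAt ℝ 2 f x) (j : Fin 3) :
    DifferentiableAt ℝ (pd j f) x :=
  ((hf.fderiv_right (m := 1) (by norm_num)).differentiableAt (by norm_num)).clm_apply
    (differentiableAt_const _)

/-- Schwarz's theorem for the partial derivatives `pd`. -/
theorem pd_comm {f : V3 → ℝ} {x : V3} (hf : ContDiffAt ℝ 2 f x) (j k : Fin 3) :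
    pd k (pd j f) x = pd j (pd k f) x := by
  have hd : DifferentiableAt ℝ (fderiv ℝ f) x :=
    (hf.fderiv_right (m := 1) (by norm_num)).differentiableAt (by norm_num)
  have key (a b : Fin 3) :
      pd a (pd b f) x = fderiv ℝ (fderiv ℝ f) x (Pi.single a 1) (Pi.single b 1) := by
    change fderiv ℝ (fun y => fderiv ℝ f y (Pi.single b 1)) x (Pi.single a 1) = _
    rw [fderiv_clm_apply hd (differentiableAt_const _)]
    simp
  rw [key, key]
  exact (hf.isSymmSndFDerivAt (by simp)).eq _ _

theorem pd_congr {f g : V3 → ℝ} {s : Set V3} (hs : IsOpen s) (h : s.EqOn f g) {x : V3}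
    (hx : x ∈ s) (k : Fin 3) : pd k f x = pd k g x := by
  simp only [pd, (h.eventuallyEq_of_mem (hs.mem_nhds hx)).fderiv_eq]

/-- Functions with equal partial derivatives on an open connected set differ by a constant. -/
theorem exists_eq_add_const {Ω : Set V3} (hΩ : IsOpen Ω) (hc : IsPreconnected Ω)
    {f g : V3 → ℝ} (hf : DifferentiableOn ℝ f Ω) (hg : DifferentiableOn ℝ g Ω)
    (h : ∀ x ∈ Ω, ∀ k, pd k f x = pd k g x) : ∃ c : ℝ, ∀ x ∈ Ω, f x = g x + c := by
  refine hΩ.exists_eq_add_of_fderiv_eq hc hf hg fun x hx => ?_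
  apply ContinuousLinearMap.coe_injective
  exact LinearMap.pi_ext' fun k => LinearMap.ext_ring (by simpa [pd] using h x hx k)

/-- On a convex open set, constancy of a partial derivative along a segment makes the function
affine there. -/
theorem add_single_eq {B : Set V3} (hB : IsOpen B) (hconv : Convex ℝ B) {f : V3 → ℝ}
    (hf : DifferentiableOn ℝ f B) {k : Fin 3} {x : V3} {s c : ℝ} (hx : x ∈ B)
    (hxs : x + Pi.single k s ∈ B)
    (h : ∀ t, x + Pi.single k t ∈ B → pd k f (x + Pi.single k t) = c) :
    f (x + Pi.single k s) = f x + s * c := by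
  have hsingle (t : ℝ) : (Pi.single k (t * s) : V3) = t • Pi.single k s := by
    rw [← Pi.single_smul]; simp
  have hmem : ∀ t ∈ Set.Icc (0 : ℝ) 1, x + Pi.single k (t * s) ∈ B := by
    intro t ht
    rw [hsingle]
    exact hconv.add_smul_mem hx hxs ht
  have hd : ∀ t ∈ Set.Icc (0 : ℝ) 1,
      HasDerivAt (fun t => f (x + Pi.single k (t * s)) - t * (s * c)) 0 t := by
    intro t ht
    have h1 : HasDerivAt (fun t : ℝ => x + (Pi.single k (t * s) : V3)) (Pi.single k s) t := by
      simp only [hsingle]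
      simpa using ((hasDerivAt_id t).smul_const (Pi.single k s : V3)).const_add x
    have h2 := (hf.differentiableAt (hB.mem_nhds (hmem t ht))).hasFDerivAt.comp_hasDerivAt t h1
    have h3 : fderiv ℝ f (x + Pi.single k (t * s)) (Pi.single k s) = s * c := by
      rw [← h _ (hmem t ht), pd, ← smul_eq_mul s, ← map_smul, ← Pi.single_smul, smul_eq_mul,
        mul_one]
    rw [h3] at h2
    have h4 := h2.sub ((hasDerivAt_id t).mul_const (s * c))
    rw [one_mul, sub_self] at h4
    exact h4
  have := constant_of_has_deriv_right_zero
    (fun t ht => (hd t ht).continuousAt.continuousWithinAt)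
    (fun t ht => (hd t (Set.Ico_subset_Icc_self ht)).hasDerivWithinAt) 1 (by simp)
  simp at this
  linarith

/-- If `∂ₖ f = 0` on a convex open set, then the partial derivatives of `f` are invariant under
translations in the direction `k`. -/
theorem pd_add_single_of_pd_eq_zero {B : Set V3} (hB : IsOpen B) (hconv : Convex ℝ B)
    {f : V3 → ℝ} (hf : DifferentiableOn ℝ f B) {k : Fin 3} (h : ∀ x ∈ B, pd k f x = 0)
    (i : Fin 3) {x : V3} {s : ℝ} (hx : x ∈ B) (hxs : x + Pi.single k s ∈ B) :
    pd i f (x + Pi.single k s) = pd i f x := by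
  have hev : (fun y => f (y + Pi.single k s)) =ᶠ[nhds x] f := by
    have hcont : Continuous fun y : V3 => y + Pi.single k s := by fun_prop
    filter_upwards [hB.mem_nhds hx, hcont.continuousAt.preimage_mem_nhds (hB.mem_nhds hxs)]
      with y hy hys
    have := add_single_eq hB hconv hf (c := 0) hy hys fun t ht => h _ ht
    rwa [mul_zero, add_zero] at this
  have := hev.fderiv_eq (𝕜 := ℝ)
  rw [fderiv_comp_add_right] at this
  simp only [pd, this]

/-- Local form: a field `P` for which `g` satisfies
`∂ₖ g i j = δᵢₖ P j - δⱼₖ P i` for `i ≠ j` is constant on balls. -/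
theorem eq_center_of_pd_offDiag {x₀ : V3} {r : ℝ} {g : Fin 3 → Fin 3 → V3 → ℝ}
    {P : Fin 3 → V3 → ℝ}
    (hg : ∀ i j, DifferentiableOn ℝ (g i j) (Metric.ball x₀ r))
    (h0 : ∀ i j k, i ≠ j → k ≠ i → k ≠ j → ∀ x ∈ Metric.ball x₀ r, pd k (g i j) x = 0)
    (h1 : ∀ i j, i ≠ j → ∀ x ∈ Metric.ball x₀ r, pd i (g i j) x = P j x)
    (h2 : ∀ i j, i ≠ j → ∀ x ∈ Metric.ball x₀ r, pd j (g i j) x = -P i x)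
    (j : Fin 3) {x : V3} (hx : x ∈ Metric.ball x₀ r) : P j x = P j x₀ := by
  have hr : 0 < r := dist_nonneg.trans_lt hx
  have hmem (y : V3) : y ∈ Metric.ball x₀ r ↔ ∀ i, |y i - x₀ i| < r := by
    rw [Metric.mem_ball, dist_pi_lt_iff hr]; rfl
  have hshift : ∀ j k, k ≠ j → ∀ y ∈ Metric.ball x₀ r, ∀ s,
      y + Pi.single k s ∈ Metric.ball x₀ r → P j (y + Pi.single k s) = P j y := by
    intro j k hkj y hy s hys
    obtain ⟨i, hij, hik⟩ : ∃ i : Fin 3, i ≠ j ∧ i ≠ k := by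
      clear hkj hys
      decide +revert
    rw [← h1 i j hij _ hys, ← h1 i j hij _ hy]
    exact pd_add_single_of_pd_eq_zero Metric.isOpen_ball (convex_ball _ _) (hg i j)
      (h0 i j k hij hik.symm hkj) i hy hys
  have hsq : ∀ h : ℝ, |h| < r → ∀ i j, i ≠ j →
      h * (P j (x₀ + Pi.single j h) - P j x₀) = -(h * (P i (x₀ + Pi.single i h) - P i x₀)) := by
    intro h hh i j hij
    have m0 : x₀ ∈ Metric.ball x₀ r := Metric.mem_ball_self hr
    have m1 (k : Fin 3) : x₀ + Pi.single k h ∈ Metric.ball x₀ r := by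
      rw [hmem]; intro l
      by_cases hl : l = k <;> simp [hl, hh, hr]
    have m2 (k l : Fin 3) (hkl : k ≠ l) :
        x₀ + Pi.single k h + Pi.single l h ∈ Metric.ball x₀ r := by
      rw [hmem]; intro m
      by_cases hm : m = k
      · subst hm; simp [hkl, hh]
      · by_cases hl : m = l
        · subst hl; simp [hm, hh]
        · simp [hm, hl, hr]
    have e1 : ∀ y ∈ Metric.ball x₀ r, y + Pi.single i h ∈ Metric.ball x₀ r →
        g i j (y + Pi.single i h) = g i j y + h * P j y := fun y hy hyh =>
      add_single_eq Metric.isOpen_ball (convex_ball _ _) (hg i j) hy hyh fun t ht => by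
        rw [h1 i j hij _ ht, hshift j i hij y hy t ht]
    have e2 : ∀ y ∈ Metric.ball x₀ r, y + Pi.single j h ∈ Metric.ball x₀ r →
        g i j (y + Pi.single j h) = g i j y + h * -P i y := fun y hy hyh =>
      add_single_eq Metric.isOpen_ball (convex_ball _ _) (hg i j) hy hyh fun t ht => by
        rw [h2 i j hij _ ht, hshift i j hij.symm y hy t ht]
    have a1 := e1 _ m0 (m1 i)
    have a2 := e2 _ m0 (m1 j)
    have a3 := e1 _ (m1 j) (m2 j i hij.symm)
    have a4 := e2 _ (m1 i) (m2 i j hij)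
    rw [add_right_comm] at a4
    linarith
  have hdiag : P j (x₀ + Pi.single j (x j - x₀ j)) = P j x₀ := by
    by_cases hz : x j - x₀ j = 0
    · simp [hz]
    obtain ⟨k, l, hkj, hlj, hkl⟩ : ∃ k l : Fin 3, k ≠ j ∧ l ≠ j ∧ k ≠ l := by
      clear hz
      revert j; decide
    have hh := (hmem x).1 hx j
    have b1 := hsq _ hh k j hkj
    have b2 := hsq _ hh l j hlj
    have b3 := hsq _ hh k l hkl
    have : (x j - x₀ j) * (P j (x₀ + Pi.single j (x j - x₀ j)) - P j x₀) = 0 := by linarith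
    exact sub_eq_zero.1 ((mul_eq_zero.1 this).resolve_left hz)
  obtain ⟨k, l, hkj, hlj, hkl, hall⟩ :
      ∃ k l : Fin 3, k ≠ j ∧ l ≠ j ∧ k ≠ l ∧ ∀ m, m = j ∨ m = k ∨ m = l := by
    clear hdiag
    revert j; decide
  set y := x₀ + Pi.single j (x j - x₀ j) with hy
  have hyl (m : Fin 3) : y m = if m = j then x j else x₀ m := by
    by_cases hm : m = j
    · subst hm; simp [hy]
    · simp [hy, hm]
  have my : y ∈ Metric.ball x₀ r := by
    rw [hmem]; intro m
    by_cases hm : m = j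
    · subst hm; simpa [hyl] using (hmem x).1 hx m
    · simpa [hyl, hm] using hr
  have mz : y + Pi.single k (x k - x₀ k) ∈ Metric.ball x₀ r := by
    rw [hmem]; intro m
    by_cases hm : m = k
    · subst hm; simpa [hyl, hkj] using (hmem x).1 hx m
    · simpa [hm] using (hmem y).1 my m
  have hxz : x = y + Pi.single k (x k - x₀ k) + Pi.single l (x l - x₀ l) := by
    ext m
    rcases hall m with rfl | rfl | rfl
    · simp [hyl, hkj.symm, hlj.symm]
    · simp [hyl, hkj, hkl]
    · simp [hyl, hlj, hkl.symm]
  rw [hxz, hshift j l hlj _ mz _ (hxz ▸ hx), hshift j k hkj _ my _ mz, hdiag]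

theorem pd_coord (k i : Fin 3) (x : V3) : pd k (fun y => y i) x = if i = k then 1 else 0 := by
  have : fderiv ℝ (fun y : V3 => y i) x = ContinuousLinearMap.proj i :=
    (ContinuousLinearMap.proj (R := ℝ) (φ := fun _ : Fin 3 => ℝ) i).fderiv
  simp [pd, this, Pi.single_apply]

theorem pd_add {f g : V3 → ℝ} {x : V3} (hf : DifferentiableAt ℝ f x)
    (hg : DifferentiableAt ℝ g x) (k : Fin 3) :
    pd k (fun y => f y + g y) x = pd k f x + pd k g x := by
  simp [pd, fderiv_fun_add hf hg]

theorem pd_sub {f g : V3 → ℝ} {x : V3} (hf : DifferentiableAt ℝ f x)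
    (hg : DifferentiableAt ℝ g x) (k : Fin 3) :
    pd k (fun y => f y - g y) x = pd k f x - pd k g x := by
  simp [pd, fderiv_fun_sub hf hg]

theorem pd_mul {f g : V3 → ℝ} {x : V3} (hf : DifferentiableAt ℝ f x)
    (hg : DifferentiableAt ℝ g x) (k : Fin 3) :
    pd k (fun y => f y * g y) x = f x * pd k g x + g x * pd k f x := by
  simp [pd, fderiv_fun_mul hf hg]

theorem pd_const (k : Fin 3) (c : ℝ) (x : V3) : pd k (fun _ => c) x = 0 := by
  simp [pd]

/-- The second derivatives of a map with conformal Jacobian, expressed through the gradient of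
the diagonal entry of the Jacobian. -/
theorem pd_pd_of_conformal {H : Fin 3 → Fin 3 → Fin 3 → ℝ} {P : Fin 3 → ℝ}
    (hsymm : ∀ i j k, H i j k = H i k j) (hskew : ∀ i j k, i ≠ j → H i j k = -H j i k)
    (hdiag : ∀ i k, H i i k = P k) (i j k : Fin 3) :
    H i j k = (if i = j then P k else 0) + (if i = k then P j else 0)
      - (if j = k then P i else 0) := by
  by_cases hij : i = j
  · subst hij
    rw [hdiag]; simp
  by_cases hik : i = k
  · subst hik
    rw [hsymm, hdiag]; simp [hij, Ne.symm hij]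
  by_cases hjk : j = k
  · subst hjk
    rw [hskew _ _ _ hij, hsymm, hdiag]; simp [hij]
  simp only [hij, hik, hjk, if_false]
  linarith [hskew i j k hij, hsymm j i k, hskew j k i hjk, hsymm k j i,
    hskew i k j hik, hsymm i j k]

theorem add_swap_grad_of_conformal {X : M3} (h : devM (symM X) = 0) (i j : Fin 3) :
    X i j + X j i = if i = j then 2 * X 0 0 else 0 := by
  have e (i j : Fin 3) := congrFun (congrFun h i) j
  have e00 := e 0 0
  have e11 := e 1 1
  have e22 := e 2 2
  have eij := e i j
  simp [devM, symM, Matrix.trace, Fin.sum_univ_three, Matrix.one_apply] at e00 e11 e22 eij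
  split_ifs at eij ⊢ <;> linarith

theorem differentiableAt_dot3 (w x : V3) : DifferentiableAt ℝ (dot3 w) x := by
  unfold dot3; fun_prop

theorem pd_dot3 (w : V3) (k : Fin 3) (x : V3) : pd k (dot3 w) x = w k := by
  have (i : Fin 3) : pd k (fun y => w i * y i) x = if i = k then w i else 0 := by
    rw [pd_mul (by fun_prop) (by fun_prop), pd_const, pd_coord]; simp
  change pd k (fun y => ∑ i, w i * y i) x = _
  simp only [Fin.sum_univ_three]
  rw [pd_add (by fun_prop) (by fun_prop), pd_add (by fun_prop) (by fun_prop), this, this, this]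
  fin_cases k <;> simp

theorem pd_sum_sq (k : Fin 3) (x : V3) : pd k (fun y => ∑ i, y i ^ 2) x = 2 * x k := by
  have (i : Fin 3) : pd k (fun y => y i ^ 2) x = if i = k then 2 * x i else 0 := by
    simp only [sq]
    rw [pd_mul (by fun_prop) (by fun_prop), pd_coord]
    split_ifs <;> ring
  simp only [Fin.sum_univ_three]
  rw [pd_add (by fun_prop) (by fun_prop), pd_add (by fun_prop) (by fun_prop), this, this, this]
  fin_cases k <;> simp

/-- The non-constant part of the Jacobian of `conf` has the second derivatives given by
`pd_pd_of_conformal`. -/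
theorem pd_affine (w : V3) (i j k : Fin 3) (x : V3) :
    pd k (fun y => (if i = j then dot3 w y else 0) + (w j * y i - w i * y j)) x
      = (if i = j then w k else 0) + (if i = k then w j else 0) - (if j = k then w i else 0) := by
  have hd := differentiableAt_dot3 w x
  have h1 : pd k (fun y => if i = j then dot3 w y else 0) x = if i = j then w k else 0 := by
    split_ifs
    · exact pd_dot3 w k x
    · exact pd_const k 0 x
  rw [pd_add (by split_ifs <;> fun_prop) (by fun_prop), pd_sub (by fun_prop) (by fun_prop),
    pd_mul (by fun_prop) (by fun_prop), pd_mul (by fun_prop) (by fun_prop), h1, pd_const, pd_const,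
    pd_coord, pd_coord]
  simp only [mul_zero, add_zero, mul_ite, mul_one]
  ring

theorem pd_conf (w b : V3) (p : ℝ) (A : M3) (i j : Fin 3) (x : V3) :
    pd j (fun y => conf w p A b y i) x
      = (if i = j then dot3 w x else 0) + (w j * x i - w i * x j)
        + ((if i = j then p else 0) + A i j) := by
  have hd := differentiableAt_dot3 w x
  have hA := differentiableAt_dot3 (A i) x
  change pd j (fun y => (1/2 : ℝ) * (2 * dot3 w y * y i - (∑ j, (y j) ^ 2) * w i)
    + p * y i + dot3 (A i) y + b i) x = _
  rw [pd_add (by fun_prop) (by fun_prop), pd_add (by fun_prop) (by fun_prop),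
    pd_add (by fun_prop) (by fun_prop), pd_mul (by fun_prop) (by fun_prop),
    pd_sub (by fun_prop) (by fun_prop), pd_mul (by fun_prop) (by fun_prop),
    pd_mul (by fun_prop) (by fun_prop), pd_mul (by fun_prop) (by fun_prop),
    pd_mul (by fun_prop) (by fun_prop), pd_sum_sq, pd_dot3, pd_dot3, pd_coord]
  simp only [pd_const]
  split_ifs <;> ring

/-- Characterization of infinitesimal conformal mappings: if `∇φ(x) ∈ ℝ·1 ⊕ so(3)`,
i.e. `dev sym ∇φ = 0` on the open connected set `Ω`, then `φ` has the conformal form. -/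
theorem conformal_characterization (Ω : Set V3) (hΩ : IsOpen Ω) (hconn : IsConnected Ω)
    (φ : V3 → V3) (hφ : ContDiffOn ℝ 2 φ Ω)
    (hconf : ∀ x ∈ Ω, devM (symM (grad φ x)) = 0) :
    ∃ (w b : V3) (p : ℝ) (A : M3), Aᵀ = -A ∧ ∀ x ∈ Ω, φ x = conf w p A b x := by
  have hφi (i : Fin 3) (x : V3) (hx : x ∈ Ω) : ContDiffAt ℝ 2 (fun y => φ y i) x :=
    contDiffAt_pi.1 (hφ.contDiffAt (hΩ.mem_nhds hx)) i
  set g : Fin 3 → Fin 3 → V3 → ℝ := fun i j => pd j (fun y => φ y i) with hg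
  have hgd (i j : Fin 3) (x : V3) (hx : x ∈ Ω) : DifferentiableAt ℝ (g i j) x :=
    differentiableAt_pd (hφi i x hx) j
  have hgs (x : V3) (hx : x ∈ Ω) (i j : Fin 3) :
      g i j x + g j i x = if i = j then 2 * g 0 0 x else 0 :=
    add_swap_grad_of_conformal (hconf x hx) i j
  set P : Fin 3 → V3 → ℝ := fun k => pd k (g 0 0) with hP
  have hH (x : V3) (hx : x ∈ Ω) (i j k : Fin 3) :
      pd k (g i j) x = (if i = j then P k x else 0) + (if i = k then P j x else 0)
        - (if j = k then P i x else 0) := by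
    refine pd_pd_of_conformal (H := fun i j k => pd k (g i j) x) (P := fun k => P k x)
      (fun i j k => pd_comm (hφi i x hx) j k) (fun i j k hij => ?_) (fun i k => ?_) i j k
    · have : Ω.EqOn (g i j) (fun y => 0 - g j i y) := fun y hy => by
        have := hgs y hy i j
        simp only [hij, if_false] at this
        linarith
      rw [pd_congr hΩ this hx k, pd_sub (differentiableAt_const _) (hgd j i x hx), pd_const,
        zero_sub]
    · have : Ω.EqOn (g i i) (g 0 0) := fun y hy => by
        have := hgs y hy i i
        simp only [if_true] at this
        linarith
      exact pd_congr hΩ this hx k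
  have hloc (j : Fin 3) : ∀ x ∈ Ω, P j =ᶠ[nhds x] fun _ => P j x := by
    intro x hx
    obtain ⟨r, hr, hball⟩ := Metric.isOpen_iff.1 hΩ x hx
    filter_upwards [Metric.ball_mem_nhds x hr] with y hy
    refine eq_center_of_pd_offDiag (g := g)
      (fun i j z hz => (hgd i j z (hball hz)).differentiableWithinAt)
      (fun i j k hij hki hkj z hz => ?_) (fun i j hij z hz => ?_) (fun i j hij z hz => ?_) j hy
    · rw [hH z (hball hz)]; simp [hij, hki.symm, hkj.symm]
    · rw [hH z (hball hz)]; simp [hij, hij.symm]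
    · rw [hH z (hball hz)]; simp [hij]
  have hPc (j : Fin 3) : ∃ c : ℝ, ∀ x ∈ Ω, P j x = c :=
    hΩ.exists_is_const_of_fderiv_eq_zero (𝕜 := ℝ) hconn.isPreconnected
      (fun x hx => ((differentiableAt_const _).congr_of_eventuallyEq
        (hloc j x hx)).differentiableWithinAt)
      (fun x hx => by rw [(hloc j x hx).fderiv_eq (𝕜 := ℝ)]; simp)
  choose w hw using hPc
  have hC (i j : Fin 3) : ∃ c, ∀ x ∈ Ω,
      g i j x = (if i = j then dot3 w x else 0) + (w j * x i - w i * x j) + c := by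
    refine exists_eq_add_const hΩ hconn.isPreconnected
      (fun x hx => (hgd i j x hx).differentiableWithinAt) ?_ fun x hx k => ?_
    · simp only [dot3]; split_ifs <;> fun_prop
    · rw [pd_affine, hH x hx]; simp only [hw _ x hx]
  choose C hC using hC
  obtain ⟨x₁, hx₁⟩ := hconn.nonempty
  have hCs (i j : Fin 3) : C i j + C j i = if i = j then 2 * C 0 0 else 0 := by
    have := hgs x₁ hx₁ i j
    rw [hC i j x₁ hx₁, hC j i x₁ hx₁, hC 0 0 x₁ hx₁] at this
    by_cases hij : i = j
    · subst hij; simp at this ⊢; linarith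
    · simp [hij, Ne.symm hij] at this ⊢; linarith
  set A : M3 := Matrix.of fun i j => if i = j then 0 else C i j with hA
  have hb (i : Fin 3) : ∃ c, ∀ x ∈ Ω, φ x i = conf w (C 0 0) A 0 x i + c := by
    refine exists_eq_add_const hΩ hconn.isPreconnected
      (fun x hx => ((hφi i x hx).differentiableAt (by norm_num)).differentiableWithinAt)
      ?_ fun x hx j => ?_
    · simp only [conf, dot3, Matrix.mulVec, dotProduct]; fun_prop
    · rw [pd_conf]
      refine (hC i j x hx).trans ?_
      have := hCs i j
      by_cases hij : i = j
      · subst hij; simp [hA] at this ⊢; linarith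
      · simp [hA, hij]
  choose b hb using hb
  refine ⟨w, b, C 0 0, A, ?_, fun x hx => ?_⟩
  · ext i j
    have := hCs i j
    by_cases hij : i = j
    · subst hij; simp [hA]
    · simp [hA, hij, Ne.symm hij] at this ⊢; linarith
  · ext i
    rw [hb i x hx]; simp [conf]
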